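/- Let S be a set of pmfs such that ⋀S exists, and let α ∈ [0,∞] be a Rényi entropy order. Then the minimum Rényi entropy of couplings of S satisfies H_α(⋀S) ≤ H*_α(S) ≤ H_α(⋀S) + H_α(Geom_{1/2}); in particular, for Shannon entropy (α = 1), H(⋀S) ≤ H*(S) ≤ H(⋀S) + 2. -/

import Mathlib

open scoped ENNReal Classical
open Filter

namespace MEC

/-- A probability mass function on `α`: (nonnegative) masses summing to `1`. -/
def IsPMF {α : Type*} (p : α → ℝ≥0∞) : Prop := ∑' x, p x = 1

/-- `p` is an aggregation of `q`, written `q ⊑ p`: there is a map `g` sending the support of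
`q` into the support of `p` such that `p` is the pushforward of `q` under `g`. -/
def Agg {α β : Type*} (q : α → ℝ≥0∞) (p : β → ℝ≥0∞) : Prop :=
  ∃ g : α → β, (∀ x, q x ≠ 0 → p (g x) ≠ 0) ∧
    ∀ y, p y = ∑' x, if g x = y then q x else 0

/-- Sum of the `k` largest masses of `p`, i.e. `max_{A, |A| ≤ k} p(A)`. -/
noncomputable def topk {α : Type*} (p : α → ℝ≥0∞) (k : ℕ) : ℝ≥0∞ :=
  ⨆ (A : Finset α) (_ : A.card ≤ k), ∑ x ∈ A, p x

/-- `q` is majorized by `p`, written `q ⪯ p`: for every `k`, the sum of the `k` largest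
masses of `q` is at most the sum of the `k` largest masses of `p`. -/
def Majorized {α β : Type*} (q : α → ℝ≥0∞) (p : β → ℝ≥0∞) : Prop :=
  ∀ k : ℕ, topk q k ≤ topk p k

/-- Product pmf `(q × r)(x,z) = q(x) · r(z)`. -/
noncomputable def prodFun {α β : Type*} (q : α → ℝ≥0∞) (r : β → ℝ≥0∞) : α × β → ℝ≥0∞ :=
  fun z => q z.1 * r z.2

/-- `Geom_{1/2}` on `ℕ+ = {1,2,3,...}`, with mass `2^{-x}` at `x`. -/
noncomputable def geomHalf : ℕ+ → ℝ≥0∞ := fun x => 2⁻¹ ^ (x : ℕ)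

/-- Capped geometric distribution `CGeom_{1/2,k}` on `{1,...,k} ⊆ ℕ+`. -/
noncomputable def cgeomHalf (k : ℕ) : ℕ+ → ℝ≥0∞ := fun x =>
  if (x : ℕ) < k then 2⁻¹ ^ (x : ℕ) else if (x : ℕ) = k then 2⁻¹ ^ (k - 1) else 0

/-- `inf_{p ∈ S} max_{A ⊆ supp(p), |A| ≤ k} p(A)`. -/
noncomputable def infTopk {α : Type*} (S : Set (α → ℝ≥0∞)) (k : ℕ) : ℝ≥0∞ :=
  ⨅ p ∈ S, topk p k

/-- The greatest lower bound `⋀S` of `S` with respect to majorization, as a pmf on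
`ℕ+ = {1,2,...}`, with `(⋀S)(k) = inf_{p∈S} max_{|A|≤k} p(A) − inf_{p∈S} max_{|A|≤k−1} p(A)`. -/
noncomputable def glb {α : Type*} (S : Set (α → ℝ≥0∞)) : ℕ+ → ℝ≥0∞ :=
  fun k => infTopk S (k : ℕ) - infTopk S ((k : ℕ) - 1)

/-- Condition for the existence of `⋀S`:
`lim_{k→∞} inf_{p∈S} max_{A⊆supp(p), |A|≤k} p(A) = 1`. -/
def GlbExists {α : Type*} (S : Set (α → ℝ≥0∞)) : Prop :=
  Tendsto (fun k => infTopk S k) atTop (nhds 1)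

/-- Base-2 logarithm on `ℝ≥0∞` (intended for arguments in `[1,∞]`). -/
noncomputable def log2 (x : ℝ≥0∞) : ℝ≥0∞ :=
  if x = ∞ then ∞ else ENNReal.ofReal (Real.logb 2 x.toReal)

/-- Shannon entropy (base 2): `H(p) = Σ_x p(x) log₂ (1/p(x))`. -/
noncomputable def shannon {α : Type*} (p : α → ℝ≥0∞) : ℝ≥0∞ :=
  ∑' x, p x * log2 (p x)⁻¹

/-- Rényi entropy of order `a ∈ [0,∞]` (base 2):
`H_a(p) = (1/(1−a)) log₂ Σ_{x ∈ supp(p)} p(x)^a` for `a ∉ {1,∞}` (for `a > 1` this is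
written in the equivalent form `(1/(a−1)) log₂ (Σ_{x ∈ supp(p)} p(x)^a)⁻¹` so that it is
nonnegative), Shannon entropy for `a = 1`, and `−log₂ max_x p(x)` for `a = ∞`. -/
noncomputable def renyi {α : Type*} (p : α → ℝ≥0∞) (a : ℝ≥0∞) : ℝ≥0∞ :=
  if a = 1 then shannon p
  else if a = ∞ then log2 (⨆ x, p x)⁻¹
  else if a < 1 then log2 (∑' x, if p x = 0 then 0 else p x ^ a.toReal) * (1 - a)⁻¹
  else log2 (∑' x, if p x = 0 then 0 else p x ^ a.toReal)⁻¹ * (a - 1)⁻¹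

/-- `q ∈ Γ̃(S)`: `q` (a pmf over `ℕ`, without loss of generality) is an underlying
distribution of a coupling of `S`, i.e. `q ⊑ p` for every `p ∈ S`. -/
def UnderlyingCoupling {α : Type*} (S : Set (α → ℝ≥0∞)) (q : ℕ → ℝ≥0∞) : Prop :=
  IsPMF q ∧ ∀ p ∈ S, Agg q p

/-- `H*_a(S) = inf_{q ∈ Γ̃(S)} H_a(q)`, the minimum Rényi entropy of couplings of `S`. -/
noncomputable def minRenyi {α : Type*} (S : Set (α → ℝ≥0∞)) (a : ℝ≥0∞) : ℝ≥0∞ :=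
  ⨅ (q : ℕ → ℝ≥0∞) (_ : UnderlyingCoupling S q), renyi q a

/-! ### Majorization and the greatest lower bound -/

section Majorization

variable {α β : Type*}

theorem sum_le_topk (p : α → ℝ≥0∞) {A : Finset α} {k : ℕ} (hA : A.card ≤ k) :
    ∑ x ∈ A, p x ≤ topk p k :=
  le_iSup₂_of_le A hA le_rfl

theorem topk_le_iff (p : α → ℝ≥0∞) (k : ℕ) (c : ℝ≥0∞) :
    topk p k ≤ c ↔ ∀ A : Finset α, A.card ≤ k → ∑ x ∈ A, p x ≤ c :=
  iSup₂_le_iff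

theorem topk_zero (p : α → ℝ≥0∞) : topk p 0 = 0 := by
  refine le_antisymm ((topk_le_iff _ _ _).2 fun A hA => ?_) zero_le
  simp [Finset.card_eq_zero.1 (Nat.le_zero.1 hA)]

theorem topk_mono (p : α → ℝ≥0∞) : Monotone (topk p) := fun _ _ h =>
  (topk_le_iff _ _ _).2 fun _ hA => sum_le_topk p (hA.trans h)

theorem topk_one (p : α → ℝ≥0∞) : topk p 1 = ⨆ x, p x := by
  refine le_antisymm ((topk_le_iff _ _ _).2 fun A hA => ?_) (iSup_le fun x => ?_)
  · rcases A.eq_empty_or_nonempty with rfl | ⟨x, hx⟩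
    · simp
    · have : A = {x} := Finset.eq_singleton_iff_unique_mem.2
        ⟨hx, fun y hy => Finset.card_le_one.1 hA y hy x hx⟩
      rw [this, Finset.sum_singleton]
      exact le_iSup p x
  · simpa using sum_le_topk p (A := {x}) (k := 1) (by simp)

theorem topk_concave (p : α → ℝ≥0∞) (k : ℕ) :
    topk p (k + 2) + topk p k ≤ topk p (k + 1) + topk p (k + 1) := by
  refine ENNReal.biSup_add_biSup_le' (p := fun A : Finset α => A.card ≤ k + 2)
    (q := fun A : Finset α => A.card ≤ k) ⟨∅, by simp⟩ ⟨∅, by simp⟩ fun B hB C hC => ?_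
  rcases Nat.lt_or_ge (k + 1) B.card with h | h
  · obtain ⟨b, hb, hbC⟩ : ∃ b ∈ B, b ∉ C :=
      Finset.exists_mem_notMem_of_card_lt_card (by omega)
    have h1 : (B.erase b).card ≤ k + 1 := by
      rw [Finset.card_erase_of_mem hb]; omega
    have h2 : (insert b C).card ≤ k + 1 := by
      rw [Finset.card_insert_of_notMem hbC]; omega
    refine le_trans (le_of_eq ?_) (add_le_add (sum_le_topk p h1) (sum_le_topk p h2))
    rw [Finset.sum_insert hbC, ← Finset.sum_erase_add B p hb, add_assoc]
  · exact add_le_add (sum_le_topk p h) (sum_le_topk p (by omega))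

theorem Agg.topk_le {q : α → ℝ≥0∞} {p : β → ℝ≥0∞} (h : Agg q p) (k : ℕ) :
    topk q k ≤ topk p k := by
  obtain ⟨g, -, hg⟩ := h
  refine (topk_le_iff _ _ _).2 fun A hA => ?_
  refine le_trans ?_ (sum_le_topk p (A := A.image g) (Finset.card_image_le.trans hA))
  rw [← Finset.sum_fiberwise_of_maps_to (fun x hx => Finset.mem_image_of_mem g hx)]
  refine Finset.sum_le_sum fun y _ => ?_
  rw [hg y, Finset.sum_filter]
  exact ENNReal.sum_le_tsum _

theorem IsPMF.topk_le_one {p : α → ℝ≥0∞} (hp : IsPMF p) (k : ℕ) : topk p k ≤ 1 :=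
  (topk_le_iff _ _ _).2 fun A _ => (ENNReal.sum_le_tsum A).trans_eq hp

theorem IsPMF.le_one {p : α → ℝ≥0∞} (hp : IsPMF p) (x : α) : p x ≤ 1 :=
  (ENNReal.le_tsum x).trans_eq hp

theorem infTopk_le {S : Set (α → ℝ≥0∞)} {p : α → ℝ≥0∞} (hp : p ∈ S) (k : ℕ) :
    infTopk S k ≤ topk p k :=
  iInf₂_le p hp

theorem infTopk_mono (S : Set (α → ℝ≥0∞)) : Monotone (infTopk S) := fun _ _ h =>
  iInf₂_mono fun p _ => topk_mono p h

theorem infTopk_concave (S : Set (α → ℝ≥0∞)) (k : ℕ) :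
    infTopk S (k + 2) + infTopk S k ≤ infTopk S (k + 1) + infTopk S (k + 1) := by
  rw [← two_mul, mul_comm, ← ENNReal.div_le_iff (by simp) (by simp)]
  refine le_iInf₂ fun p hp => ?_
  rw [ENNReal.div_le_iff (by simp) (by simp), mul_comm, two_mul]
  exact (add_le_add (infTopk_le hp _) (infTopk_le hp _)).trans (topk_concave p k)

theorem GlbExists.nonempty {S : Set (α → ℝ≥0∞)} (hex : GlbExists S) : S.Nonempty := by
  rw [Set.nonempty_iff_ne_empty]
  rintro rfl
  simp [GlbExists, infTopk] at hex

section Glb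

variable {S : Set (α → ℝ≥0∞)}

theorem infTopk_ne_top (hS : ∀ p ∈ S, IsPMF p) (hne : S.Nonempty) (k : ℕ) :
    infTopk S k ≠ ∞ := by
  obtain ⟨p, hp⟩ := hne
  exact (((infTopk_le hp k).trans ((hS p hp).topk_le_one k)).trans_lt ENNReal.one_lt_top).ne

theorem infTopk_zero (hne : S.Nonempty) : infTopk S 0 = 0 := by
  obtain ⟨p, hp⟩ := hne
  exact le_antisymm ((infTopk_le hp 0).trans_eq (topk_zero p)) zero_le

theorem sum_range_glb (hne : S.Nonempty) (k : ℕ) :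
    ∑ n ∈ Finset.range k, glb S n.succPNat = infTopk S k := by
  induction k with
  | zero => simp [infTopk_zero hne]
  | succ k ih =>
    rw [Finset.sum_range_succ, ih]
    simpa [glb] using add_tsub_cancel_of_le (infTopk_mono S k.le_succ)

theorem glb_antitone (hS : ∀ p ∈ S, IsPMF p) (hne : S.Nonempty) :
    Antitone fun n : ℕ => glb S n.succPNat := by
  refine antitone_nat_of_succ_le fun k => ?_
  have h1 := infTopk_concave S k
  have hk := infTopk_ne_top hS hne k
  have hk1 := infTopk_ne_top hS hne (k + 1)
  have e1 : glb S (k + 1).succPNat = infTopk S (k + 2) - infTopk S (k + 1) := by simp [glb]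
  have e2 : glb S k.succPNat = infTopk S (k + 1) - infTopk S k := by simp [glb]
  show glb S (k + 1).succPNat ≤ glb S k.succPNat
  rw [e1, e2, tsub_le_iff_right]
  refine (ENNReal.add_le_add_iff_right hk).1 (h1.trans_eq ?_)
  rw [add_right_comm, tsub_add_cancel_of_le (infTopk_mono S k.le_succ)]

theorem sum_le_sum_range_card {f : ℕ → ℝ≥0∞} (hf : Antitone f) (A : Finset ℕ) :
    ∑ n ∈ A, f n ≤ ∑ n ∈ Finset.range A.card, f n := by
  induction A using Finset.induction_on_max with
  | empty => simp
  | insert a s hs ih =>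
    have ha : a ∉ s := fun h => lt_irrefl _ (hs a h)
    have hcard : s.card ≤ a := by
      simpa using Finset.card_le_card (fun x hx => Finset.mem_range.2 (hs x hx))
    rw [Finset.sum_insert ha, Finset.card_insert_of_notMem ha, Finset.sum_range_succ, add_comm]
    exact add_le_add ih (hf hcard)

theorem topk_glb (hS : ∀ p ∈ S, IsPMF p) (hne : S.Nonempty) (k : ℕ) :
    topk (glb S) k = infTopk S k := by
  have hinj : Function.Injective Nat.succPNat := Nat.succPNat_injective
  refine le_antisymm ((topk_le_iff _ _ _).2 fun A hA => ?_) ?_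
  · have hA' : (A.map Equiv.pnatEquivNat.toEmbedding).card ≤ k := by simpa using hA
    have h := sum_le_sum_range_card (glb_antitone hS hne) (A.map Equiv.pnatEquivNat.toEmbedding)
    rw [sum_range_glb hne] at h
    simpa using h.trans (infTopk_mono S hA')
  · rw [← sum_range_glb hne]
    refine le_trans (le_of_eq ?_) (sum_le_topk (glb S)
      (A := (Finset.range k).map ⟨Nat.succPNat, hinj⟩) (by simp))
    simp

theorem isPMF_glb (hne : S.Nonempty) (hex : GlbExists S) : IsPMF (glb S) := by
  have h := ENNReal.tendsto_nat_tsum fun n => glb S n.succPNat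
  simp only [sum_range_glb hne] at h
  rw [IsPMF, ← Equiv.pnatEquivNat.symm.tsum_eq]
  exact tendsto_nhds_unique h hex

end Glb

theorem tsum_min_add_tsum_sub (p : α → ℝ≥0∞) (s : ℝ≥0∞) :
    ∑' x, min (p x) s + ∑' x, (p x - s) = ∑' x, p x := by
  rw [← ENNReal.tsum_add]
  refine tsum_congr fun x => ?_
  rcases le_total (p x) s with h | h
  · rw [min_eq_left h, tsub_eq_zero_of_le h, add_zero]
  · rw [min_eq_right h, add_tsub_cancel_of_le h]

theorem Majorized.tsum_sub_le {q : α → ℝ≥0∞} {p : β → ℝ≥0∞} (h : Majorized q p)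
    {s : ℝ≥0∞} (hs : s ≠ ∞) : ∑' x, (q x - s) ≤ ∑' y, (p y - s) := by
  refine ENNReal.summable.tsum_le_of_sum_le fun A => ?_
  set A' := A.filter fun x => s ≤ q x
  have e : ∑ x ∈ A, (q x - s) = ∑ x ∈ A', (q x - s) := by
    refine (Finset.sum_filter_of_ne fun x _ hx => ?_).symm
    by_contra hlt
    exact hx (tsub_eq_zero_of_le (not_le.1 hlt).le)
  have hc : (A'.card : ℝ≥0∞) * s ≠ ∞ := ENNReal.mul_ne_top (by simp) hs
  rw [e]
  refine (ENNReal.add_le_add_iff_right hc).1 ?_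
  calc ∑ x ∈ A', (q x - s) + A'.card * s = ∑ x ∈ A', q x := by
        rw [← nsmul_eq_mul, ← Finset.sum_const, ← Finset.sum_add_distrib]
        exact Finset.sum_congr rfl fun x hx => tsub_add_cancel_of_le (Finset.mem_filter.1 hx).2
    _ ≤ topk p A'.card := (sum_le_topk q le_rfl).trans (h _)
    _ ≤ _ := (topk_le_iff _ _ _).2 fun B hB => ?_
  calc ∑ y ∈ B, p y ≤ ∑ y ∈ B, ((p y - s) + s) := Finset.sum_le_sum fun y _ => le_tsub_add
    _ = ∑ y ∈ B, (p y - s) + B.card * s := by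
        rw [Finset.sum_add_distrib, Finset.sum_const, nsmul_eq_mul]
    _ ≤ _ := by
        gcongr
        exact ENNReal.sum_le_tsum B

theorem Majorized.tsum_min_le {q : α → ℝ≥0∞} {p : β → ℝ≥0∞} (h : Majorized q p)
    (hq : IsPMF q) (hp : IsPMF p) {s : ℝ≥0∞} (hs : s ≠ ∞) :
    ∑' y, min (p y) s ≤ ∑' x, min (q x) s := by
  have e1 := tsum_min_add_tsum_sub q s
  have e2 := tsum_min_add_tsum_sub p s
  rw [hq] at e1
  rw [hp] at e2
  have hfin : ∑' y, (p y - s) ≠ ∞ := fun h => by simp [h] at e2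
  refine (ENNReal.add_le_add_iff_right hfin).1 ?_
  rw [e2, ← e1]
  gcongr
  exact h.tsum_sub_le hs

end Majorization

/-! ### Greedy filling -/

section Greedy

variable {α ι : Type*}

theorem exists_greedy_enumeration (w : ι → ℝ≥0∞) (hw : ∑' z, w z ≠ ∞)
    (hinf : (Function.support w).Infinite) :
    ∃ e : ℕ → ι, Function.Injective e ∧ (∀ m n, m ≤ n → w (e n) ≤ w (e m)) ∧
      (∀ n, w (e n) ≠ 0) ∧ Function.support w ⊆ Set.range e := by
  have key : ∀ F : Finset ι, ∃ z, z ∉ F ∧ w z ≠ 0 ∧ ∀ z', z' ∉ F → w z' ≤ w z := by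
    intro F
    obtain ⟨z₀, hz₀, hz₀F⟩ := hinf.exists_notMem_finset F
    have hfin := ENNReal.finite_const_le_of_tsum_ne_top hw hz₀
    obtain ⟨z, hz, hmax⟩ := (hfin.toFinset \ F).exists_max_image w ⟨z₀, by simp [hz₀F]⟩
    simp only [Finset.mem_sdiff, Set.Finite.mem_toFinset, Set.mem_ofPred_eq] at hz hmax
    refine ⟨z, hz.2, fun h => hz₀ (le_antisymm (hz.1.trans_eq h) zero_le), fun z' hz' => ?_⟩
    rcases le_total (w z₀) (w z') with h | h
    · exact hmax z' ⟨h, hz'⟩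
    · exact h.trans hz.1
  choose c hcF hc0 hcmax using key
  let F : ℕ → Finset ι := fun n => n.rec ∅ fun _ G => insert (c G) G
  have hF : ∀ n, F (n + 1) = insert (c (F n)) (F n) := fun n => rfl
  have hmono : Monotone F := monotone_nat_of_le_succ fun n => by
    rw [hF]; exact Finset.subset_insert _ _
  have hmem : ∀ m n, m < n → c (F m) ∈ F n := fun m n h =>
    hmono (Nat.succ_le_of_lt h) (by rw [hF]; exact Finset.mem_insert_self _ _)
  have hinj : Function.Injective fun n => c (F n) := by
    refine Function.Injective.of_lt_imp_ne fun m n h heq => ?_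
    exact hcF (F n) (heq ▸ hmem m n h)
  have hFe : ∀ n z, z ∈ F n → ∃ m, c (F m) = z := by
    intro n
    induction n with
    | zero => intro z hz; simp [F] at hz
    | succ n ih =>
      intro z hz
      rw [hF, Finset.mem_insert] at hz
      exact hz.elim (fun h => ⟨n, h.symm⟩) (ih z)
  refine ⟨fun n => c (F n), hinj, fun m n h => hcmax _ _ fun hm => hcF _ (hmono h hm),
    fun n => hc0 _, fun z hz => ?_⟩
  by_contra hnot
  have hge : ∀ n, w z ≤ w (c (F n)) := fun n =>
    hcmax _ _ fun hz' => hnot (hFe n z hz')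
  refine hw (top_unique ?_)
  calc (∞ : ℝ≥0∞) = ∑' _ : ℕ, w z := (ENNReal.tsum_const_eq_top_of_ne_zero hz).symm
    _ ≤ ∑' n, w (c (F n)) := ENNReal.tsum_le_tsum hge
    _ ≤ _ := ENNReal.tsum_comp_le_tsum_of_injective hinj w

theorem sum_Icc_inv_two_pow (M : ℕ) :
    ∑ j ∈ Finset.Icc 1 M, (2⁻¹ : ℝ≥0∞) ^ j + 2⁻¹ ^ M = 1 := by
  induction M with
  | zero => simp
  | succ M ih =>
    rw [Finset.sum_Icc_succ_top (by omega), add_assoc, pow_succ, ← mul_add,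
      ENNReal.inv_two_add_inv_two, mul_one, ih]

theorem sum_geomHalf_add_le {c t : ℝ≥0∞} (hct : t ≤ c) (G : Finset ℕ+)
    (hG : ∀ j ∈ G, t ≤ c * geomHalf j) : ∑ j ∈ G, c * geomHalf j + t ≤ c := by
  set G' : Finset ℕ := G.map ⟨_, PNat.coe_injective⟩
  have e : ∑ j ∈ G, c * geomHalf j = c * ∑ j ∈ G', 2⁻¹ ^ j := by
    simp [G', geomHalf, Finset.mul_sum]
  set M := G'.sup id
  have hM : t ≤ c * 2⁻¹ ^ M := by
    rcases G.eq_empty_or_nonempty with h | h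
    · simpa [M, G', h] using hct
    · obtain ⟨j, hj, hjM⟩ := Finset.exists_mem_eq_sup G' (by simpa [G'] using h) id
      obtain ⟨i, hi, rfl⟩ := Finset.mem_map.1 hj
      have := hG i hi
      simpa [M, hjM, geomHalf] using this
  have hsub : G' ⊆ Finset.Icc 1 M := by
    intro j hj
    refine Finset.mem_Icc.2 ⟨?_, Finset.le_sup (f := id) hj⟩
    obtain ⟨i, -, rfl⟩ := Finset.mem_map.1 hj
    exact i.2
  calc ∑ j ∈ G, c * geomHalf j + t
      ≤ c * ∑ j ∈ Finset.Icc 1 M, 2⁻¹ ^ j + c * 2⁻¹ ^ M := by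
        rw [e]
        gcongr
    _ = c := by rw [← mul_add, sum_Icc_inv_two_pow, mul_one]

theorem sum_prodFun_geomHalf_add_le (r : ι → ℝ≥0∞) {t : ℝ≥0∞} (I : Finset ι)
    (hI : ∀ i, i ∈ I ↔ t ≤ r i) (F : Finset (ι × ℕ+))
    (hF : ∀ z ∈ F, t ≤ prodFun r geomHalf z) :
    ∑ z ∈ F, prodFun r geomHalf z + I.card * t ≤ ∑ i ∈ I, r i := by
  have hmap : ∀ z ∈ F, z.1 ∈ I := by
    intro z hz
    refine (hI _).2 ((hF z hz).trans ?_)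
    calc r z.1 * geomHalf z.2 ≤ r z.1 * 1 := by
          gcongr
          exact pow_le_one₀ zero_le (by simp)
      _ = r z.1 := mul_one _
  rw [← Finset.sum_fiberwise_of_maps_to hmap, ← nsmul_eq_mul, ← Finset.sum_const,
    ← Finset.sum_add_distrib]
  refine Finset.sum_le_sum fun i hi => ?_
  have hinj : Set.InjOn Prod.snd (↑(F.filter fun z => z.1 = i) : Set (ι × ℕ+)) := by
    intro z hz z' hz' h
    simp only [Finset.coe_filter, Set.mem_ofPred_eq] at hz hz'
    exact Prod.ext (hz.2.trans hz'.2.symm) h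
  have e : ∑ z ∈ F with z.1 = i, prodFun r geomHalf z =
      ∑ j ∈ (F.filter fun z => z.1 = i).image Prod.snd, r i * geomHalf j := by
    rw [Finset.sum_image hinj]
    refine Finset.sum_congr rfl fun z hz => ?_
    rw [prodFun, (Finset.mem_filter.1 hz).2]
  rw [e]
  refine sum_geomHalf_add_le ((hI i).1 hi) _ fun j hj => ?_
  obtain ⟨z, hz, rfl⟩ := Finset.mem_image.1 hj
  obtain ⟨hzF, rfl⟩ := Finset.mem_filter.1 hz
  exact hF z hzF

theorem agg_of_forall_exists_fit {p : α → ℝ≥0∞} {q : ℕ → ℝ≥0∞} (hp : IsPMF p) (hq : IsPMF q)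
    (hq0 : ∀ n, q n ≠ 0)
    (step : ∀ (n : ℕ) (L : α → ℝ≥0∞), ∑' y, L y = ∑ m ∈ Finset.range n, q m →
      ∃ y, L y + q n ≤ p y) : Agg q p := by
  obtain ⟨y₀, -⟩ := step 0 0 (by simp)
  have step' : ∀ (n : ℕ) (L : α → ℝ≥0∞), ∃ y, ∑' y, L y = ∑ m ∈ Finset.range n, q m →
      L y + q n ≤ p y := by
    intro n L
    by_cases h : ∑' y, L y = ∑ m ∈ Finset.range n, q m
    · exact (step n L h).imp fun y hy _ => hy
    · exact ⟨y₀, fun h' => absurd h' h⟩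
  choose c hc using step'
  let L : ℕ → α → ℝ≥0∞ := fun n =>
    n.rec 0 fun n L y => L y + if c n L = y then q n else 0
  have hL : ∀ n y, L (n + 1) y = L n y + if c n (L n) = y then q n else 0 := fun n y => rfl
  have hsum : ∀ n, ∑' y, L n y = ∑ m ∈ Finset.range n, q m := by
    intro n
    induction n with
    | zero => simp [L]
    | succ n ih =>
      simp only [hL, ENNReal.tsum_add, ih, Finset.sum_range_succ]
      simp
  have hle : ∀ n y, L n y ≤ p y := by
    intro n
    induction n with
    | zero => intro y; simp [L]
    | succ n ih =>
      intro y
      rw [hL]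
      split_ifs with h
      · exact h ▸ hc n (L n) (hsum n)
      · simpa using ih y
  have hLsum : ∀ n y, L n y = ∑ m ∈ Finset.range n, if c m (L m) = y then q m else 0 := by
    intro n y
    induction n with
    | zero => simp [L]
    | succ n ih => rw [hL, Finset.sum_range_succ, ih]
  have hfib : ∀ y, (∑' m, if c m (L m) = y then q m else 0) ≤ p y := fun y =>
    ENNReal.tsum_le_of_sum_range_le fun n => (hLsum n y).symm.trans_le (hle n y)
  have htot : ∑' y, (∑' m, if c m (L m) = y then q m else 0) = 1 := by
    rw [ENNReal.tsum_comm, ← hq]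
    exact tsum_congr fun m => by simp
  refine ⟨fun n => c n (L n), fun n _ h0 => hq0 n ?_, fun y => ?_⟩
  · have := hc n (L n) (hsum n)
    rw [h0] at this
    exact le_antisymm (le_add_self.trans this) zero_le
  · by_contra hne
    have hlt := lt_of_le_of_ne (hfib y) (Ne.symm hne)
    have := ENNReal.tsum_lt_tsum (by rw [htot]; simp) hfib hlt
    rw [htot, hp] at this
    exact lt_irrefl _ this

theorem isPMF_geomHalf : IsPMF geomHalf := by
  have h := ENNReal.tsum_geometric_add_one (2⁻¹ : ℝ≥0∞)
  rw [ENNReal.one_sub_inv_two, inv_inv, ENNReal.inv_mul_cancel (by simp) (by simp)] at h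
  rw [IsPMF, ← Equiv.pnatEquivNat.symm.tsum_eq, ← h]
  exact tsum_congr fun n => by simp [geomHalf]

theorem IsPMF.prodFun {β : Type*} {q : α → ℝ≥0∞} {r : β → ℝ≥0∞} (hq : IsPMF q) (hr : IsPMF r) :
    IsPMF (prodFun q r) := by
  rw [IsPMF] at *
  simp only [MEC.prodFun, ENNReal.tsum_prod (f := fun x z => q x * r z), ENNReal.tsum_mul_left, hr,
    mul_one, hq]

theorem exists_enumeration_agg {r : ι → ℝ≥0∞} (hr : IsPMF r) :
    ∃ e : ℕ → ι × ℕ+, Function.Injective e ∧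
      Function.support (prodFun r geomHalf) ⊆ Set.range e ∧
      IsPMF (prodFun r geomHalf ∘ e) ∧
      ∀ (p : α → ℝ≥0∞), IsPMF p → Majorized r p → Agg (prodFun r geomHalf ∘ e) p := by
  set w := prodFun r geomHalf
  have hw : IsPMF w := hr.prodFun isPMF_geomHalf
  have hwfin : ∑' z, w z ≠ ∞ := by rw [hw]; simp
  obtain ⟨i, hi⟩ : ∃ i, r i ≠ 0 := by
    by_contra! h
    simp [IsPMF, h] at hr
  have hinf : (Function.support w).Infinite := by
    refine Set.infinite_of_injective_forall_mem (f := fun j : ℕ+ => (i, j))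
      (fun _ _ h => (Prod.ext_iff.1 h).2) fun j => ?_
    simp [w, prodFun, geomHalf, hi]
  obtain ⟨e, he, hanti, hpos, hsupp⟩ := exists_greedy_enumeration w hwfin hinf
  have hq : IsPMF (w ∘ e) := (he.tsum_eq hsupp).trans hw
  refine ⟨e, he, hsupp, hq, fun p hp hmaj => agg_of_forall_exists_fit hp hq hpos
    fun n L hL => ?_⟩
  set t := w (e n)
  have htop : t ≠ ∞ := ((hw.le_one _).trans_lt ENNReal.one_lt_top).ne
  have hrfin : ∑' i, r i ≠ ∞ := by rw [hr]; simp
  set I := (ENNReal.finite_const_le_of_tsum_ne_top hrfin (hpos n)).toFinset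
  have hI : ∀ i, i ∈ I ↔ t ≤ r i := fun i => by simp [I, t]
  have h := sum_prodFun_geomHalf_add_le r I hI
    ((Finset.range (n + 1)).map ⟨e, he⟩) (by
      intro z hz
      obtain ⟨m, hm, rfl⟩ := Finset.mem_map.1 hz
      exact hanti _ _ (Nat.lt_succ_iff.1 (Finset.mem_range.1 hm)))
  rw [Finset.sum_map, Finset.sum_range_succ] at h
  have h' : ∑' y, L y + I.card * t + t ≤ topk p I.card := by
    rw [hL, add_right_comm]
    exact h.trans ((sum_le_topk r le_rfl).trans (hmaj _))
  have hLfin : ∑' y, L y ≠ ∞ := by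
    rw [hL]
    exact ((ENNReal.sum_le_tsum _).trans_lt (hq.trans_lt ENNReal.one_lt_top)).ne
  have hlt : ∑' y, L y + I.card * t < topk p I.card :=
    (ENNReal.lt_add_right (ENNReal.add_ne_top.2 ⟨hLfin, ENNReal.mul_ne_top (by simp) htop⟩)
      (hpos n)).trans_le h'
  by_contra! hno
  refine hlt.not_ge ((topk_le_iff _ _ _).2 fun A hA => ?_)
  calc ∑ y ∈ A, p y ≤ ∑ y ∈ A, (L y + t) := Finset.sum_le_sum fun y _ => (hno y).le
    _ = ∑ y ∈ A, L y + A.card * t := by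
        rw [Finset.sum_add_distrib, Finset.sum_const, nsmul_eq_mul]
    _ ≤ _ := by
        gcongr
        exact ENNReal.sum_le_tsum A

end Greedy

/-! ### Schur concavity of the Rényi entropies -/

section SchurConcavity

open MeasureTheory

/-- Averaging the truncations `min t s` against the density `s ^ c` on `(0, 1]`. For suitable `c`
this recovers `t ↦ t ^ a` and `t ↦ -t log t` up to linear terms. -/
noncomputable def truncMean (c : ℝ) (t : ℝ≥0∞) : ℝ≥0∞ :=
  ∫⁻ s in Set.Ioc (0 : ℝ) 1, min t (ENNReal.ofReal s) * ENNReal.ofReal (s ^ c)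

theorem Majorized.tsum_truncMean_le {α β : Type*} [Countable α] [Countable β]
    {q : α → ℝ≥0∞} {p : β → ℝ≥0∞} (h : Majorized q p) (hq : IsPMF q) (hp : IsPMF p) (c : ℝ) :
    ∑' y, truncMean c (p y) ≤ ∑' x, truncMean c (q x) := by
  have hmeas : ∀ t : ℝ≥0∞, AEMeasurable
      (fun s : ℝ => min t (ENNReal.ofReal s) * ENNReal.ofReal (s ^ c))
      (volume.restrict (Set.Ioc (0 : ℝ) 1)) := fun t => by
    refine Measurable.aemeasurable ?_
    fun_prop
  simp only [truncMean]
  rw [← lintegral_tsum fun y => hmeas _, ← lintegral_tsum fun x => hmeas _]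
  refine lintegral_mono fun s => ?_
  simp only [ENNReal.tsum_mul_right]
  gcongr
  exact h.tsum_min_le hq hp ENNReal.ofReal_ne_top

theorem truncMean_zero (c : ℝ) : truncMean c 0 = 0 := by simp [truncMean]

theorem lintegral_Ioc_ofReal {f : ℝ → ℝ} {a b : ℝ} (hab : a ≤ b)
    (hf : IntervalIntegrable f volume a b) (h0 : ∀ s ∈ Set.Ioc a b, 0 ≤ f s) :
    ∫⁻ s in Set.Ioc a b, ENNReal.ofReal (f s) = ENNReal.ofReal (∫ s in a..b, f s) := by
  rw [intervalIntegral.integral_of_le hab, ofReal_integral_eq_lintegral_ofReal]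
  · exact (intervalIntegrable_iff_integrableOn_Ioc_of_le hab).1 hf
  · exact (ae_restrict_iff' measurableSet_Ioc).2 (Eventually.of_forall h0)

theorem truncMean_ofReal {a t : ℝ} (ha : 0 < a) (ht : 0 < t) (ht1 : t ≤ 1) :
    truncMean (a - 2) (ENNReal.ofReal t) =
      ENNReal.ofReal (t ^ a / a + t * ∫ s in t..1, s ^ (a - 2)) := by
  have h0 : (0 : ℝ) ∉ Set.uIcc t 1 := by
    rw [Set.uIcc_of_le ht1]
    exact fun h => ht.not_ge h.1
  have hint : IntervalIntegrable (fun s : ℝ => s ^ (a - 2)) volume t 1 :=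
    intervalIntegral.intervalIntegrable_rpow (Or.inr h0)
  have e1 : ∫⁻ s in Set.Ioc (0 : ℝ) t,
      min (ENNReal.ofReal t) (ENNReal.ofReal s) * ENNReal.ofReal (s ^ (a - 2)) =
      ENNReal.ofReal (t ^ a / a) := by
    have : ∫ s in (0 : ℝ)..t, s ^ (a - 1) = t ^ a / a := by
      rw [integral_rpow (Or.inl (by linarith)), sub_add_cancel, Real.zero_rpow ha.ne', sub_zero]
    rw [← this, ← lintegral_Ioc_ofReal ht.le
      (intervalIntegral.intervalIntegrable_rpow' (by linarith))
      fun s hs => Real.rpow_nonneg hs.1.le _]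
    refine setLIntegral_congr_fun measurableSet_Ioc fun s hs => ?_
    have hs0 : 0 < s := hs.1
    show min (ENNReal.ofReal t) (ENNReal.ofReal s) * ENNReal.ofReal (s ^ (a - 2)) = _
    rw [min_eq_right (ENNReal.ofReal_le_ofReal hs.2), ← ENNReal.ofReal_mul hs0.le]
    congr 1
    rw [show a - 1 = 1 + (a - 2) by ring, Real.rpow_add hs0, Real.rpow_one]
  have e2 : ∫⁻ s in Set.Ioc t 1,
      min (ENNReal.ofReal t) (ENNReal.ofReal s) * ENNReal.ofReal (s ^ (a - 2)) =
      ENNReal.ofReal (t * ∫ s in t..1, s ^ (a - 2)) := by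
    rw [← intervalIntegral.integral_const_mul, ← lintegral_Ioc_ofReal ht1 (hint.const_mul t)
      fun s hs => mul_nonneg ht.le (Real.rpow_nonneg (ht.trans hs.1).le _)]
    refine setLIntegral_congr_fun measurableSet_Ioc fun s hs => ?_
    show min (ENNReal.ofReal t) (ENNReal.ofReal s) * ENNReal.ofReal (s ^ (a - 2)) = _
    rw [min_eq_left (ENNReal.ofReal_le_ofReal hs.1.le), ← ENNReal.ofReal_mul ht.le]
  rw [truncMean, ← Set.Ioc_union_Ioc_eq_Ioc ht.le ht1,
    lintegral_union measurableSet_Ioc (Set.Ioc_disjoint_Ioc_of_le le_rfl), e1, e2,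
    ← ENNReal.ofReal_add (by positivity)]
  exact mul_nonneg ht.le (intervalIntegral.integral_nonneg ht1 fun s hs =>
    Real.rpow_nonneg (ht.le.trans hs.1) _)

theorem truncMean_rpow {a t : ℝ} (ha : 0 < a) (ha1 : a ≠ 1) (ht : 0 < t) (ht1 : t ≤ 1) :
    truncMean (a - 2) (ENNReal.ofReal t) = ENNReal.ofReal ((t - t ^ a / a) / (a - 1)) := by
  have h0 : (0 : ℝ) ∉ Set.uIcc t 1 := by
    rw [Set.uIcc_of_le ht1]
    exact fun h => ht.not_ge h.1
  have ha1' : a - 1 ≠ 0 := sub_ne_zero.2 ha1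
  rw [truncMean_ofReal ha ht ht1,
    integral_rpow (Or.inr ⟨fun h => ha1 (by linarith), h0⟩), Real.one_rpow,
    show a - 2 + 1 = a - 1 by ring]
  congr 1
  have : t ^ a = t * t ^ (a - 1) := by
    rw [← Real.rpow_one_add' ht.le (by simpa using ha.ne')]
    congr 1
    ring
  rw [this]
  field_simp
  ring

theorem rpow_eq_add_truncMean {a : ℝ} (ha : 0 < a) (ha1 : a < 1) {t : ℝ≥0∞} (ht : t ≤ 1) :
    t ^ a = ENNReal.ofReal a * t + ENNReal.ofReal (a * (1 - a)) * truncMean (a - 2) t := by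
  rcases eq_or_ne t 0 with rfl | h0
  · simp [truncMean_zero, ha]
  have htop : t ≠ ∞ := (ht.trans_lt ENNReal.one_lt_top).ne
  have hx : 0 < t.toReal := ENNReal.toReal_pos h0 htop
  have hx1 : t.toReal ≤ 1 := ENNReal.toReal_mono ENNReal.one_ne_top ht
  rw [← ENNReal.ofReal_toReal htop]
  generalize t.toReal = x at hx hx1
  have hge : a * x ≤ x ^ a := by
    have : x ≤ x ^ a := by
      simpa using Real.rpow_le_rpow_of_exponent_ge hx hx1 ha1.le
    nlinarith
  rw [truncMean_rpow ha ha1.ne hx hx1, ENNReal.ofReal_rpow_of_pos hx,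
    ← ENNReal.ofReal_mul ha.le, ← ENNReal.ofReal_mul (by nlinarith), ← ENNReal.ofReal_add]
  · congr 1
    have : a - 1 ≠ 0 := by linarith
    field_simp
    ring
  · positivity
  · have : a * (1 - a) * ((x - x ^ a / a) / (a - 1)) = x ^ a - a * x := by
      have : a - 1 ≠ 0 := by linarith
      field_simp
      ring
    rw [this]
    linarith

theorem rpow_add_truncMean {a : ℝ} (ha1 : 1 < a) {t : ℝ≥0∞} (ht : t ≤ 1) :
    t ^ a + ENNReal.ofReal (a * (a - 1)) * truncMean (a - 2) t = ENNReal.ofReal a * t := by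
  have ha : 0 < a := by linarith
  rcases eq_or_ne t 0 with rfl | h0
  · simp [truncMean_zero, ha]
  have htop : t ≠ ∞ := (ht.trans_lt ENNReal.one_lt_top).ne
  have hx : 0 < t.toReal := ENNReal.toReal_pos h0 htop
  have hx1 : t.toReal ≤ 1 := ENNReal.toReal_mono ENNReal.one_ne_top ht
  rw [← ENNReal.ofReal_toReal htop]
  generalize t.toReal = x at hx hx1
  have hge : x ^ a ≤ a * x := by
    have : x ^ a ≤ x := by
      simpa using Real.rpow_le_rpow_of_exponent_ge hx hx1 ha1.le
    nlinarith
  have e : a * (a - 1) * ((x - x ^ a / a) / (a - 1)) = a * x - x ^ a := by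
    have : a - 1 ≠ 0 := by linarith
    field_simp
  rw [truncMean_rpow ha ha1.ne' hx hx1, ENNReal.ofReal_rpow_of_pos hx,
    ← ENNReal.ofReal_mul ha.le, ← ENNReal.ofReal_mul (by nlinarith), ← ENNReal.ofReal_add, e]
  · congr 1
    ring
  · positivity
  · rw [e]
    linarith

theorem log2_inv_ofReal {x : ℝ} (hx : 0 < x) :
    log2 (ENNReal.ofReal x)⁻¹ = ENNReal.ofReal (-Real.logb 2 x) := by
  rw [log2, if_neg (by simpa using hx), ENNReal.toReal_inv, ENNReal.toReal_ofReal hx.le,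
    Real.logb_inv]

theorem mul_log2_inv_add_truncMean {t : ℝ≥0∞} (ht : t ≤ 1) :
    ENNReal.ofReal (Real.log 2) * (t * log2 t⁻¹) + t = truncMean (-1) t := by
  rcases eq_or_ne t 0 with rfl | h0
  · simp [truncMean_zero]
  have htop : t ≠ ∞ := (ht.trans_lt ENNReal.one_lt_top).ne
  have hx : 0 < t.toReal := ENNReal.toReal_pos h0 htop
  have hx1 : t.toReal ≤ 1 := ENNReal.toReal_mono ENNReal.one_ne_top ht
  rw [← ENNReal.ofReal_toReal htop]
  generalize t.toReal = x at hx hx1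
  have hl2 : 0 < Real.log 2 := Real.log_pos one_lt_two
  have hlog : 0 ≤ -Real.logb 2 x :=
    neg_nonneg.2 (Real.logb_nonpos one_lt_two hx.le hx1)
  rw [show (-1 : ℝ) = 1 - 2 by norm_num, truncMean_ofReal one_pos hx hx1, log2_inv_ofReal hx,
    ← ENNReal.ofReal_mul hx.le, ← ENNReal.ofReal_mul hl2.le, ← ENNReal.ofReal_add _ hx.le]
  · congr 1
    have : ∫ s in x..1, s ^ (1 - 2 : ℝ) = -Real.log x := by
      rw [show (1 - 2 : ℝ) = -1 by norm_num]
      simp only [Real.rpow_neg_one]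
      rw [integral_inv_of_pos hx one_pos, one_div, Real.log_inv]
    rw [this, Real.logb, Real.rpow_one]
    field_simp
    ring
  · positivity

theorem log2_mono : Monotone log2 := by
  intro x y h
  rcases eq_or_ne y ∞ with rfl | hy
  · simp [log2]
  have hx : x ≠ ∞ := (h.trans_lt hy.lt_top).ne
  rw [log2, log2, if_neg hx, if_neg hy]
  rcases eq_or_ne x 0 with rfl | hx0
  · simp
  · exact ENNReal.ofReal_le_ofReal (Real.logb_le_logb_of_le one_lt_two
      (ENNReal.toReal_pos hx0 hx) (ENNReal.toReal_mono hy h))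

theorem ite_zero_rpow {a : ℝ} (ha : 0 < a) (t : ℝ≥0∞) :
    (if t = 0 then 0 else t ^ a) = t ^ a := by
  split_ifs with h
  · simp [h, ha]
  · rfl

variable {α β : Type*} {q : α → ℝ≥0∞} {p : β → ℝ≥0∞}

theorem Majorized.tsum_support_le (h : Majorized q p) (hq : IsPMF q) (hp : IsPMF p) :
    (∑' y, if p y = 0 then 0 else 1 : ℝ≥0∞) ≤ ∑' x, if q x = 0 then 0 else 1 := by
  refine ENNReal.summable.tsum_le_of_sum_le fun B => ?_
  set B' := B.filter fun y => p y ≠ 0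
  have e : (∑ y ∈ B, if p y = 0 then 0 else 1 : ℝ≥0∞) = B'.card := by
    simp [B', Finset.sum_ite]
  rw [e]
  rcases B'.eq_empty_or_nonempty with h0 | hne
  · simp [h0]
  obtain ⟨y₀, hy₀, hmin⟩ := B'.exists_min_image p hne
  have hs0 : p y₀ ≠ 0 := (Finset.mem_filter.1 hy₀).2
  have hs : p y₀ ≠ ∞ := ((hp.le_one y₀).trans_lt ENNReal.one_lt_top).ne
  refine (ENNReal.mul_le_mul_iff_left hs0 hs).1 ?_
  calc (B'.card : ℝ≥0∞) * p y₀ = ∑ y ∈ B', min (p y) (p y₀) := by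
        rw [← nsmul_eq_mul, ← Finset.sum_const]
        exact Finset.sum_congr rfl fun y hy => (min_eq_right (hmin y hy)).symm
    _ ≤ ∑' y, min (p y) (p y₀) := ENNReal.sum_le_tsum _
    _ ≤ ∑' x, min (q x) (p y₀) := h.tsum_min_le hq hp hs
    _ ≤ _ := by
      rw [← ENNReal.tsum_mul_right]
      refine ENNReal.tsum_le_tsum fun x => ?_
      split_ifs with hx
      · simp [hx]
      · simp

variable [Countable α] [Countable β]

theorem Majorized.tsum_rpow_le (h : Majorized q p) (hq : IsPMF q) (hp : IsPMF p) {a : ℝ}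
    (ha : 0 < a) (ha1 : a < 1) : ∑' y, p y ^ a ≤ ∑' x, q x ^ a := by
  simp only [rpow_eq_add_truncMean ha ha1 (hp.le_one _), rpow_eq_add_truncMean ha ha1 (hq.le_one _),
    ENNReal.tsum_add, ENNReal.tsum_mul_left]
  rw [hp, hq]
  gcongr
  exact h.tsum_truncMean_le hq hp _

theorem Majorized.le_tsum_rpow (h : Majorized q p) (hq : IsPMF q) (hp : IsPMF p) {a : ℝ}
    (ha1 : 1 < a) : ∑' x, q x ^ a ≤ ∑' y, p y ^ a := by
  have e1 := tsum_congr (L := .unconditional _) fun x => rpow_add_truncMean ha1 (hq.le_one x)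
  have e2 := tsum_congr (L := .unconditional _) fun y => rpow_add_truncMean ha1 (hp.le_one y)
  simp only [ENNReal.tsum_add, ENNReal.tsum_mul_left] at e1 e2
  rw [hq, mul_one] at e1
  rw [hp, mul_one] at e2
  have hle : ENNReal.ofReal (a * (a - 1)) * ∑' y, truncMean (a - 2) (p y) ≤
      ENNReal.ofReal (a * (a - 1)) * ∑' x, truncMean (a - 2) (q x) := by
    gcongr
    exact h.tsum_truncMean_le hq hp _
  refine (ENNReal.add_le_add_iff_right (a := ENNReal.ofReal (a * (a - 1)) *
    ∑' y, truncMean (a - 2) (p y)) ?_).1 ?_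
  · exact ((le_add_self.trans_eq e2).trans_lt ENNReal.ofReal_lt_top).ne
  · rw [e2, ← e1]
    gcongr

theorem Majorized.shannon_le (h : Majorized q p) (hq : IsPMF q) (hp : IsPMF p) :
    shannon p ≤ shannon q := by
  have e1 := tsum_congr (L := .unconditional _) fun x => mul_log2_inv_add_truncMean (hq.le_one x)
  have e2 := tsum_congr (L := .unconditional _) fun y => mul_log2_inv_add_truncMean (hp.le_one y)
  simp only [ENNReal.tsum_add, ENNReal.tsum_mul_left] at e1 e2
  rw [hq] at e1
  rw [hp] at e2
  have hle := h.tsum_truncMean_le hq hp (-1)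
  rw [← e1, ← e2, ENNReal.add_le_add_iff_right ENNReal.one_ne_top] at hle
  exact (ENNReal.mul_le_mul_iff_right (by simpa using Real.log_pos one_lt_two)
    ENNReal.ofReal_ne_top).1 hle

theorem Majorized.renyi_le (h : Majorized q p) (hq : IsPMF q) (hp : IsPMF p) (a : ℝ≥0∞) :
    renyi p a ≤ renyi q a := by
  unfold renyi
  split_ifs with h1 h2 h3
  · exact h.shannon_le hq hp
  · refine log2_mono (ENNReal.inv_le_inv.2 ?_)
    rw [← topk_one, ← topk_one]
    exact h 1
  · gcongr
    refine log2_mono ?_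
    rcases eq_or_ne a 0 with rfl | h0
    · simpa using h.tsum_support_le hq hp
    · have ha : 0 < a.toReal := ENNReal.toReal_pos h0 h2
      simp only [ite_zero_rpow ha]
      exact h.tsum_rpow_le hq hp ha (by simpa using ENNReal.toReal_strict_mono (by simp) h3)
  · have ha : 1 < a.toReal := by
      simpa using ENNReal.toReal_strict_mono h2 (lt_of_le_of_ne (not_lt.1 h3) (Ne.symm h1))
    gcongr
    refine log2_mono (ENNReal.inv_le_inv.2 ?_)
    simp only [ite_zero_rpow (one_pos.trans ha)]
    exact h.le_tsum_rpow hq hp ha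

end SchurConcavity

/-! ### Additivity of the Rényi entropies -/

section Additivity

variable {α β : Type*}

theorem log2_mul {x y : ℝ≥0∞} (hx : 1 ≤ x) (hy : 1 ≤ y) : log2 (x * y) = log2 x + log2 y := by
  have hx0 : x ≠ 0 := (one_pos.trans_le hx).ne'
  have hy0 : y ≠ 0 := (one_pos.trans_le hy).ne'
  rcases eq_or_ne x ∞ with rfl | hxt
  · simp [log2, ENNReal.top_mul hy0]
  rcases eq_or_ne y ∞ with rfl | hyt
  · simp [log2, ENNReal.mul_top hx0]
  have hx1 : 1 ≤ x.toReal := by simpa using ENNReal.toReal_mono hxt hx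
  have hy1 : 1 ≤ y.toReal := by simpa using ENNReal.toReal_mono hyt hy
  rw [log2, log2, log2, if_neg (ENNReal.mul_ne_top hxt hyt), if_neg hxt, if_neg hyt,
    ENNReal.toReal_mul, Real.logb_mul (by positivity) (by positivity),
    ENNReal.ofReal_add (Real.logb_nonneg one_lt_two hx1) (Real.logb_nonneg one_lt_two hy1)]

theorem log2_inv_mul {x y : ℝ≥0∞} (hx : x ≤ 1) (hy : y ≤ 1) :
    log2 (x * y)⁻¹ = log2 x⁻¹ + log2 y⁻¹ := by
  rw [ENNReal.mul_inv (Or.inr (hy.trans_lt ENNReal.one_lt_top).ne)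
    (Or.inl (hx.trans_lt ENNReal.one_lt_top).ne),
    log2_mul (ENNReal.one_le_inv.2 hx) (ENNReal.one_le_inv.2 hy)]

theorem tsum_prodFun (q : α → ℝ≥0∞) (r : β → ℝ≥0∞) :
    ∑' z, prodFun q r z = (∑' x, q x) * ∑' y, r y := by
  simp only [prodFun, ENNReal.tsum_prod (f := fun x y => q x * r y), ENNReal.tsum_mul_left,
    ENNReal.tsum_mul_right]

theorem shannon_prodFun {q : α → ℝ≥0∞} {r : β → ℝ≥0∞} (hq : IsPMF q) (hr : IsPMF r) :
    shannon (prodFun q r) = shannon q + shannon r := by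
  have h : ∀ z : α × β, prodFun q r z * log2 (prodFun q r z)⁻¹ =
      prodFun (fun x => q x * log2 (q x)⁻¹) r z + prodFun q (fun y => r y * log2 (r y)⁻¹) z := by
    intro z
    simp only [prodFun]
    rw [log2_inv_mul (hq.le_one _) (hr.le_one _)]
    ring
  rw [shannon, tsum_congr h, ENNReal.tsum_add, tsum_prodFun, tsum_prodFun, hq, hr, mul_one, one_mul]
  rfl

theorem tsum_ite_rpow_prodFun {q : α → ℝ≥0∞} {r : β → ℝ≥0∞} (hq : IsPMF q) (hr : IsPMF r)
    (a : ℝ) : (∑' z, if prodFun q r z = 0 then 0 else prodFun q r z ^ a) =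
      (∑' x, if q x = 0 then 0 else q x ^ a) * ∑' y, if r y = 0 then 0 else r y ^ a := by
  rw [← tsum_prodFun]
  refine tsum_congr fun z => ?_
  rcases eq_or_ne (q z.1) 0 with h | h
  · simp [prodFun, h]
  rcases eq_or_ne (r z.2) 0 with h' | h'
  · simp [prodFun, h']
  have hz : prodFun q r z ≠ 0 := mul_ne_zero h h'
  rw [if_neg hz]
  simp only [prodFun]
  rw [if_neg h, if_neg h', ENNReal.mul_rpow_of_ne_top
    ((hq.le_one _).trans_lt ENNReal.one_lt_top).ne ((hr.le_one _).trans_lt ENNReal.one_lt_top).ne]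

theorem IsPMF.one_le_tsum_ite_rpow {q : α → ℝ≥0∞} (hq : IsPMF q) {a : ℝ} (ha : a ≤ 1) :
    1 ≤ ∑' x, if q x = 0 then 0 else q x ^ a := by
  refine hq.symm.trans_le (ENNReal.tsum_le_tsum fun x => ?_)
  split_ifs with h
  · exact h.le
  · simpa using ENNReal.rpow_le_rpow_of_exponent_ge (hq.le_one x) ha

theorem IsPMF.tsum_ite_rpow_le_one {q : α → ℝ≥0∞} (hq : IsPMF q) {a : ℝ} (ha : 1 ≤ a) :
    (∑' x, if q x = 0 then 0 else q x ^ a) ≤ 1 := by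
  refine le_trans (ENNReal.tsum_le_tsum fun x => ?_) hq.le
  split_ifs with h
  · exact zero_le
  · simpa using ENNReal.rpow_le_rpow_of_exponent_ge (hq.le_one x) ha

theorem iSup_prodFun (q : α → ℝ≥0∞) (r : β → ℝ≥0∞) :
    ⨆ z, prodFun q r z = (⨆ x, q x) * ⨆ y, r y := by
  simp_rw [prodFun, iSup_prod, ENNReal.iSup_mul, ENNReal.mul_iSup]

theorem renyi_prodFun {q : α → ℝ≥0∞} {r : β → ℝ≥0∞} (hq : IsPMF q) (hr : IsPMF r) (a : ℝ≥0∞) :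
    renyi (prodFun q r) a = renyi q a + renyi r a := by
  unfold renyi
  split_ifs with h1 h2 h3
  · exact shannon_prodFun hq hr
  · rw [iSup_prodFun, log2_inv_mul (iSup_le hq.le_one) (iSup_le hr.le_one)]
  · have ha : a.toReal ≤ 1 := by simpa using ENNReal.toReal_mono (by simp) h3.le
    rw [tsum_ite_rpow_prodFun hq hr,
      log2_mul (hq.one_le_tsum_ite_rpow ha) (hr.one_le_tsum_ite_rpow ha), add_mul]
  · have ha : 1 ≤ a.toReal := by simpa using ENNReal.toReal_mono h2 (not_lt.1 h3)
    rw [tsum_ite_rpow_prodFun hq hr,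
      log2_inv_mul (hq.tsum_ite_rpow_le_one ha) (hr.tsum_ite_rpow_le_one ha), add_mul]

theorem renyi_comp {w : β → ℝ≥0∞} {e : α → β} (he : Function.Injective e)
    (hsupp : Function.support w ⊆ Set.range e) (a : ℝ≥0∞) : renyi (w ∘ e) a = renyi w a := by
  have key : ∀ f : ℝ≥0∞ → ℝ≥0∞, f 0 = 0 → ∑' x, f ((w ∘ e) x) = ∑' y, f (w y) := by
    intro f hf
    refine he.tsum_eq (f := fun y => f (w y)) fun y hy => hsupp fun h => hy ?_
    show f (w y) = 0
    rw [h, hf]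
  have hsup : ⨆ x, (w ∘ e) x = ⨆ y, w y := by
    refine le_antisymm (iSup_comp_le w e) (iSup_le fun y => ?_)
    rcases eq_or_ne (w y) 0 with h | h
    · exact h.trans_le zero_le
    · obtain ⟨x, rfl⟩ := hsupp h
      exact le_iSup (w ∘ e) x
  unfold renyi shannon
  rw [hsup, key (fun t => t * log2 t⁻¹) (by simp),
    key (fun t => if t = 0 then 0 else t ^ a.toReal) (by simp)]

theorem shannon_geomHalf : shannon geomHalf = 2 := by
  have h : ∀ n : ℕ+, geomHalf n * log2 (geomHalf n)⁻¹ =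
      ENNReal.ofReal ((n : ℕ) * (1 / 2) ^ (n : ℕ)) := by
    intro n
    have e : geomHalf n = ENNReal.ofReal ((1 / 2) ^ (n : ℕ)) := by
      rw [ENNReal.ofReal_pow (by norm_num), one_div, ENNReal.ofReal_inv_of_pos two_pos]
      simp [geomHalf]
    have hl : -Real.logb 2 ((1 / 2) ^ (n : ℕ)) = (n : ℕ) := by
      rw [one_div, inv_pow, Real.logb_inv, neg_neg, Real.logb_pow, Real.logb_self_eq_one one_lt_two,
        mul_one]
    rw [e, log2_inv_ofReal (by positivity), hl, ← ENNReal.ofReal_mul (by positivity), mul_comm]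
  have hs := hasSum_coe_mul_geometric_of_norm_lt_one (𝕜 := ℝ) (r := 1 / 2) (by norm_num)
  have h2 : ∑' n : ℕ+, ENNReal.ofReal ((n : ℕ) * (1 / 2) ^ (n : ℕ)) =
      ∑' n : ℕ, ENNReal.ofReal (n * (1 / 2) ^ n) := by
    refine PNat.coe_injective.tsum_eq (f := fun n : ℕ => ENNReal.ofReal (n * (1 / 2) ^ n))
      fun n hn => ?_
    refine ⟨⟨n, Nat.pos_of_ne_zero ?_⟩, rfl⟩
    rintro rfl
    simp at hn
  rw [shannon, tsum_congr h, h2,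
    ← ENNReal.ofReal_tsum_of_nonneg (fun n => by positivity) hs.summable, hs.tsum_eq]
  norm_num

end Additivity

theorem renyi_glb_le_minRenyi {α : Type*} {S : Set (α → ℝ≥0∞)} (hS : ∀ p ∈ S, IsPMF p)
    (hex : GlbExists S) (a : ℝ≥0∞) : renyi (glb S) a ≤ minRenyi S a := by
  have hne := hex.nonempty
  refine le_iInf₂ fun q hq => ?_
  have hmaj : Majorized q (glb S) := fun k => by
    rw [topk_glb hS hne]
    exact le_iInf₂ fun p hp => (hq.2 p hp).topk_le k
  exact hmaj.renyi_le hq.1 (isPMF_glb hne hex) a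

theorem minRenyi_le_renyi_glb_add {α : Type*} {S : Set (α → ℝ≥0∞)} (hS : ∀ p ∈ S, IsPMF p)
    (hex : GlbExists S) (a : ℝ≥0∞) : minRenyi S a ≤ renyi (glb S) a + renyi geomHalf a := by
  have hne := hex.nonempty
  have hglb := isPMF_glb hne hex
  obtain ⟨e, he, hsupp, hq, hagg⟩ := exists_enumeration_agg (α := α) hglb
  rw [← renyi_prodFun hglb isPMF_geomHalf, ← renyi_comp he hsupp]
  refine iInf₂_le _ ⟨hq, fun p hp => hagg p (hS p hp) fun k => ?_⟩
  rw [topk_glb hS hne]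
  exact infTopk_le hp k

/-- Corollary 2, entropy bounds: if `⋀S` exists then
`H_a(⋀S) ≤ H*_a(S) ≤ H_a(⋀S) + H_a(Geom_{1/2})` for every order `a ∈ [0,∞]`;
in particular for Shannon entropy, `H(⋀S) ≤ H*(S) ≤ H(⋀S) + 2`. -/
theorem minRenyi_coupling_bounds {α : Type*} [Countable α]
    (S : Set (α → ℝ≥0∞)) (hS : ∀ p ∈ S, IsPMF p) (hex : GlbExists S) (a : ℝ≥0∞) :
    renyi (glb S) a ≤ minRenyi S a ∧
    minRenyi S a ≤ renyi (glb S) a + renyi geomHalf a ∧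
    shannon (glb S) ≤ minRenyi S 1 ∧
    minRenyi S 1 ≤ shannon (glb S) + 2 := by
  have h1 : renyi (glb S) 1 = shannon (glb S) := if_pos rfl
  have h2 : renyi geomHalf 1 = 2 := (if_pos rfl).trans shannon_geomHalf
  refine ⟨renyi_glb_le_minRenyi hS hex a, minRenyi_le_renyi_glb_add hS hex a, ?_, ?_⟩
  · rw [← h1]
    exact renyi_glb_le_minRenyi hS hex 1
  · rw [← h1, ← h2]
    exact minRenyi_le_renyi_glb_add hS hex 1

end MEC
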